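/- arXiv:1310.6244 — 6 statements merged into one kernel-verified Lean document; each statement's English description precedes it below -/
import Mathlib

section
/- Fix integers n ≥ 0 and 0 ≤ k ≤ n. Let c : ℤ × ℤ × ℤ → ℂ be a function such that c(u,v,w) = 0 whenever u < 0, v < 0 or w < 0, and such that w·c(u,v,w) = u·c(u−1,v,w−1) + v·c(u,v−1,w−1) for all integers u, v ≥ 0 and w ≥ 1. Then for all integers 0 ≤ m ≤ k and 0 ≤ i ≤ n one has binom(k,m)·c(i, n−i, k) = Σ_{a+b=m, a,b ≥ 0} binom(i,a)·binom(n−i,b)·c(i−a, n−i−b, k−m). -/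
/-- Form of `clebsch_gordan_recurrence_iterate` with independent natural number indices `p`, `q`,
summed over the antidiagonal of `m`. -/
theorem choose_mul_eq_sum_antidiagonal_of_recurrence (c : ℤ → ℤ → ℤ → ℂ)
    (hrec : ∀ u v w : ℤ, 0 ≤ u → 0 ≤ v → 1 ≤ w →
      (w : ℂ) * c u v w = (u : ℂ) * c (u - 1) v (w - 1) + (v : ℂ) * c u (v - 1) (w - 1))
    (m p q k : ℕ) (hm : m ≤ k) :
    (k.choose m : ℂ) * c p q k = ∑ x ∈ Finset.HasAntidiagonal.antidiagonal m,
      (p.choose x.1 : ℂ) * (q.choose x.2 : ℂ) * c (p - x.1) (q - x.2) (k - m) := by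
  induction m generalizing p q k with
  | zero => simp
  | succ m ih =>
    obtain ⟨k, rfl⟩ : ∃ l, k = l + 1 := ⟨k - 1, by omega⟩
    have hmk : m ≤ k := by omega
    have absorb (r a : ℕ) : ((r : ℂ) + 1) * r.choose a = (r + 1).choose (a + 1) * (a + 1) :=
      mod_cast Nat.add_one_mul_choose_eq r a
    have left : (p : ℂ) * (k.choose m * c (p - 1) q k) = ∑ x ∈ Finset.HasAntidiagonal.antidiagonal (m + 1),
        (x.1 : ℂ) * ((p.choose x.1 : ℂ) * (q.choose x.2 : ℂ)
          * c (p - x.1) (q - x.2) (k - m)) := by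
      rw [Finset.Nat.sum_antidiagonal_succ]
      cases p with
      | zero => simp
      | succ p =>
        have h := ih p q k hmk
        push_cast
        rw [add_sub_cancel_right, h, Finset.mul_sum, zero_mul, zero_add]
        refine Finset.sum_congr rfl fun x _ => ?_
        rw [add_sub_add_right_eq_sub]
        linear_combination (q.choose x.2 * c (p - x.1) (q - x.2) (k - m)) * absorb p x.1
    have right : (q : ℂ) * (k.choose m * c p (q - 1) k) = ∑ x ∈ Finset.HasAntidiagonal.antidiagonal (m + 1),
        (x.2 : ℂ) * ((p.choose x.1 : ℂ) * (q.choose x.2 : ℂ)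
          * c (p - x.1) (q - x.2) (k - m)) := by
      rw [Finset.Nat.sum_antidiagonal_succ']
      cases q with
      | zero => simp
      | succ q =>
        have h := ih p q k hmk
        push_cast
        rw [add_sub_cancel_right, h, Finset.mul_sum, zero_mul, zero_add]
        refine Finset.sum_congr rfl fun x _ => ?_
        rw [add_sub_add_right_eq_sub]
        linear_combination (p.choose x.1 * c (p - x.1) (q - x.2) (k - m)) * absorb q x.2
    have hr := hrec p q (k + 1) (by positivity) (by positivity) (by omega)
    rw [add_sub_cancel_right] at hr
    push_cast at hr ⊢
    rw [add_sub_add_right_eq_sub]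
    have hsum : ((m : ℂ) + 1) * ∑ x ∈ Finset.HasAntidiagonal.antidiagonal (m + 1),
        (p.choose x.1 : ℂ) * (q.choose x.2 : ℂ) * c (p - x.1) (q - x.2) (k - m)
        = p * (k.choose m * c (p - 1) q k) + q * (k.choose m * c p (q - 1) k) := by
      rw [left, right, ← Finset.sum_add_distrib, Finset.mul_sum]
      refine Finset.sum_congr rfl fun x hx => ?_
      have hx' : (x.1 : ℂ) + x.2 = m + 1 := mod_cast Finset.HasAntidiagonal.mem_antidiagonal.mp hx
      rw [← hx', add_mul]
    refine mul_left_cancel₀ (Nat.cast_add_one_ne_zero m : (m : ℂ) + 1 ≠ 0) ?_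
    rw [hsum]
    linear_combination (k.choose m : ℂ) * hr - c p q (k + 1) * absorb k m


/-- The recurrence `w·c(u,v,w) = u·c(u−1,v,w−1) + v·c(u,v−1,w−1)` (with `c` vanishing for
negative indices) propagates down binomially: `binom(k,m)·c(i,n−i,k)` equals the binomially
weighted sum of the values `c(i−a, n−i−b, k−m)` over `a + b = m`. -/
theorem clebsch_gordan_recurrence_iterate (n k : ℕ) (hk : k ≤ n) (c : ℤ → ℤ → ℤ → ℂ)
    (hzero : ∀ u v w : ℤ, (u < 0 ∨ v < 0 ∨ w < 0) → c u v w = 0)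
    (hrec : ∀ u v w : ℤ, 0 ≤ u → 0 ≤ v → 1 ≤ w →
      (w : ℂ) * c u v w = (u : ℂ) * c (u - 1) v (w - 1) + (v : ℂ) * c u (v - 1) (w - 1))
    (m i : ℕ) (hm : m ≤ k) (hi : i ≤ n) :
    (Nat.choose k m : ℂ) * c (i : ℤ) ((n : ℤ) - (i : ℤ)) (k : ℤ)
      = ∑ a ∈ Finset.range (m + 1),
          (Nat.choose i a : ℂ) * (Nat.choose (n - i) (m - a) : ℂ)
            * c ((i : ℤ) - (a : ℤ)) ((n : ℤ) - (i : ℤ) - ((m : ℤ) - (a : ℤ)))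
                ((k : ℤ) - (m : ℤ)) := by
  have h := choose_mul_eq_sum_antidiagonal_of_recurrence c hrec m i (n - i) k hm
  rw [Finset.Nat.sum_antidiagonal_eq_sum_range_succ_mk, Nat.cast_sub hi] at h
  rw [h]
  refine Finset.sum_congr rfl fun a ha => ?_
  rw [Nat.cast_sub (Finset.mem_range_succ_iff.mp ha)]
end

section
/- Fix integers n ≥ 0 and 0 ≤ k ≤ n. Let c : ℤ × ℤ × ℤ → ℂ be a function such that c(u,v,w) = 0 whenever u < 0, v < 0 or w < 0, such that w·c(u,v,w) = u·c(u−1,v,w−1) + v·c(u,v−1,w−1) for all integers u, v ≥ 0 and w ≥ 1, and such that c(u,v,0) = (−1)^u (n−u)! (n−v)! for all integers u, v with 0 ≤ u ≤ n, 0 ≤ v ≤ n and u + v = n − k. Then for every integer 0 ≤ i ≤ n one has c(i, n−i, k) = Σ_{a+b=k, a,b ≥ 0} (−1)^{i−a} binom(i,a) binom(n−i,b) (n−i+a)! (i+b)!. -/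
/-- Unrolling the recurrence `w c(u,v,w) = u c(u-1,v,w-1) + v c(u,v-1,w-1)` down to `w = 0`. -/
theorem recurrence_eq_sum_antidiagonal (c : ℤ → ℤ → ℤ → ℂ)
    (hrec : ∀ u v w : ℤ, 0 ≤ u → 0 ≤ v → 1 ≤ w →
      (w : ℂ) * c u v w = (u : ℂ) * c (u - 1) v (w - 1) + (v : ℂ) * c u (v - 1) (w - 1))
    (w u v : ℕ) :
    c u v w = ∑ p ∈ Finset.HasAntidiagonal.antidiagonal w,
      (u.choose p.1 : ℂ) * (v.choose p.2 : ℂ) * c ((u : ℤ) - p.1) ((v : ℤ) - p.2) 0 := by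
  induction w generalizing u v with
  | zero => simp
  | succ w ih =>
    set F : ℕ × ℕ → ℂ := fun p ↦
      (u.choose p.1 : ℂ) * (v.choose p.2 : ℂ) * c ((u : ℤ) - p.1) ((v : ℤ) - p.2) 0 with hF
    have hu : (u : ℂ) * c ((u : ℤ) - 1) v w
        = ∑ p ∈ Finset.HasAntidiagonal.antidiagonal (w + 1), (p.1 : ℂ) * F p := by
      rw [Finset.Nat.sum_antidiagonal_succ]
      rcases u with _ | u
      · simp [hF]
      · have h1 : (((u + 1 : ℕ) : ℤ) - 1) = (u : ℤ) := by simp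
        rw [h1, ih, Finset.mul_sum]
        simp only [Nat.cast_zero, zero_mul, zero_add]
        refine Finset.sum_congr rfl fun p _ ↦ ?_
        have h2 : ((u : ℂ) + 1) * (u.choose p.1 : ℂ)
            = ((u + 1).choose (p.1 + 1) : ℂ) * ((p.1 : ℂ) + 1) := by
          exact_mod_cast Nat.add_one_mul_choose_eq u p.1
        have h3 : ((u + 1 : ℕ) : ℤ) - (p.1 + 1 : ℕ) = (u : ℤ) - p.1 := by push_cast; ring
        simp only [hF, h3]
        push_cast
        linear_combination (v.choose p.2 : ℂ) * c ((u : ℤ) - p.1) ((v : ℤ) - p.2) 0 * h2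
    have hv : (v : ℂ) * c u ((v : ℤ) - 1) w
        = ∑ p ∈ Finset.HasAntidiagonal.antidiagonal (w + 1), (p.2 : ℂ) * F p := by
      rw [Finset.Nat.sum_antidiagonal_succ']
      rcases v with _ | v
      · simp [hF]
      · have h1 : (((v + 1 : ℕ) : ℤ) - 1) = (v : ℤ) := by simp
        rw [h1, ih, Finset.mul_sum]
        simp only [Nat.cast_zero, zero_mul, zero_add]
        refine Finset.sum_congr rfl fun p _ ↦ ?_
        have h2 : ((v : ℂ) + 1) * (v.choose p.2 : ℂ)
            = ((v + 1).choose (p.2 + 1) : ℂ) * ((p.2 : ℂ) + 1) := by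
          exact_mod_cast Nat.add_one_mul_choose_eq v p.2
        have h3 : ((v + 1 : ℕ) : ℤ) - (p.2 + 1 : ℕ) = (v : ℤ) - p.2 := by push_cast; ring
        simp only [hF, h3]
        push_cast
        linear_combination (u.choose p.1 : ℂ) * c ((u : ℤ) - p.1) ((v : ℤ) - p.2) 0 * h2
    have h := hrec u v ((w + 1 : ℕ) : ℤ) (by positivity) (by positivity) (by push_cast; omega)
    have hw : ((w + 1 : ℕ) : ℤ) - 1 = (w : ℤ) := by simp
    rw [hw, Int.cast_natCast, Int.cast_natCast, Int.cast_natCast, hu, hv,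
      ← Finset.sum_add_distrib] at h
    refine mul_left_cancel₀ (Nat.cast_ne_zero.mpr w.succ_ne_zero : ((w + 1 : ℕ) : ℂ) ≠ 0) ?_
    rw [h, Finset.mul_sum]
    refine Finset.sum_congr rfl fun p hp ↦ ?_
    rw [← Finset.HasAntidiagonal.mem_antidiagonal.mp hp]
    push_cast
    ring


/-- Closed formula for the inverse Clebsch–Gordan coefficients `c(i, n−i, k)` of the normalized
`sl(2)`-equivariant projection `Sym^n V ⊗ Sym^n V → Sym^{2k} V`, given the recurrence and the
initial values `c(u,v,0) = (−1)^u (n−u)! (n−v)!` for `u + v = n − k`. -/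
theorem clebsch_gordan_closed_formula (n k : ℕ) (hk : k ≤ n) (c : ℤ → ℤ → ℤ → ℂ)
    (hzero : ∀ u v w : ℤ, (u < 0 ∨ v < 0 ∨ w < 0) → c u v w = 0)
    (hrec : ∀ u v w : ℤ, 0 ≤ u → 0 ≤ v → 1 ≤ w →
      (w : ℂ) * c u v w = (u : ℂ) * c (u - 1) v (w - 1) + (v : ℂ) * c u (v - 1) (w - 1))
    (hinit : ∀ u v : ℕ, u ≤ n → v ≤ n → u + v = n - k →
      c (u : ℤ) (v : ℤ) 0
        = (-1 : ℂ) ^ u * (Nat.factorial (n - u) : ℂ) * (Nat.factorial (n - v) : ℂ)) :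
    ∀ i : ℕ, i ≤ n →
      c (i : ℤ) ((n : ℤ) - (i : ℤ)) (k : ℤ)
        = ∑ a ∈ Finset.range (k + 1),
            (-1 : ℂ) ^ ((i : ℤ) - (a : ℤ)) * (Nat.choose i a : ℂ)
              * (Nat.choose (n - i) (k - a) : ℂ)
              * (Nat.factorial (n - i + a) : ℂ) * (Nat.factorial (i + (k - a)) : ℂ) := by
  intro i hi
  have hni : (n : ℤ) - (i : ℤ) = ((n - i : ℕ) : ℤ) := by omega
  rw [hni, recurrence_eq_sum_antidiagonal c hrec, Finset.Nat.sum_antidiagonal_eq_sum_range_succ_mk]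
  refine Finset.sum_congr rfl fun a ha ↦ ?_
  have hak : a ≤ k := Nat.lt_succ_iff.mp (Finset.mem_range.mp ha)
  rcases lt_or_ge i a with hia | hia
  · simp [Nat.choose_eq_zero_of_lt hia]
  rcases lt_or_ge (n - i) (k - a) with hb | hb
  · simp [Nat.choose_eq_zero_of_lt hb]
  have h := hinit (i - a) (n - i - (k - a)) (by omega) (by omega) (by omega)
  rw [show n - (i - a) = n - i + a by omega,
    show n - (n - i - (k - a)) = i + (k - a) by omega, Nat.cast_sub hia, Nat.cast_sub hb] at h
  rw [h, ← Nat.cast_sub hia, zpow_natCast]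
  ring
end

section
/- Let n ≥ 0 and 0 ≤ k ≤ n be integers. Let M_k = Σ_{i=0}^{n−k} binom(k+i,i) E_{i,k+i} ∈ End(V_n), where E_{i,j} ∈ End(V_n) denotes the elementary endomorphism sending g_{n,j} to g_{n,i} and all other basis vectors to 0. Then R_n M_k − M_k R_n = 0 and H_n M_k − M_k H_n = 2k·M_k; that is, M_k is a highest weight vector of weight 2k for the adjoint sl(2)-action on End(V_n). -/
noncomputable section

/-- The lowering operator `L_n` on `V_n = ℂ^{n+1}`, determined by
`L_n g_{n,i} = (n - i) g_{n,i+1}`. -/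
def Lop (n : ℕ) : (Fin (n + 1) → ℂ) →ₗ[ℂ] (Fin (n + 1) → ℂ) :=
  Matrix.toLin' (fun j i => if (j : ℕ) = (i : ℕ) + 1 then ((n : ℂ) - (i : ℕ)) else 0)

/-- The raising operator `R_n` on `V_n = ℂ^{n+1}`, determined by
`R_n g_{n,i} = i g_{n,i-1}`. -/
def Rop (n : ℕ) : (Fin (n + 1) → ℂ) →ₗ[ℂ] (Fin (n + 1) → ℂ) :=
  Matrix.toLin' (fun j i => if (i : ℕ) = (j : ℕ) + 1 then ((i : ℕ) : ℂ) else 0)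

/-- The Cartan operator `H_n = R_n L_n − L_n R_n`, so that `H_n g_{n,i} = (n−2i) g_{n,i}`. -/
def Hop (n : ℕ) : (Fin (n + 1) → ℂ) →ₗ[ℂ] (Fin (n + 1) → ℂ) :=
  (Rop n).comp (Lop n) - (Lop n).comp (Rop n)

/-- The endomorphism `M_k = Σ_{i=0}^{n−k} binom(k+i,i) E_{i,k+i}` of `V_n`, where
`E_{i,j}` sends `g_{n,j}` to `g_{n,i}` and kills the other basis vectors. -/
def Mop (n k : ℕ) : (Fin (n + 1) → ℂ) →ₗ[ℂ] (Fin (n + 1) → ℂ) :=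
  Matrix.toLin' (fun r c =>
    if (c : ℕ) = (r : ℕ) + k then ((Nat.choose (k + (r : ℕ)) (r : ℕ)) : ℂ) else 0)

theorem sum_fin_ite_val_eq {N m : ℕ} (f : Fin N → ℂ) :
    ∑ c : Fin N, (if (c : ℕ) = m then f c else 0) = if h : m < N then f ⟨m, h⟩ else 0 := by
  split_ifs with h
  · rw [Finset.sum_eq_single ⟨m, h⟩]
    · simp
    · intro b _ hb
      exact if_neg fun e => hb (Fin.ext e)
    · simp
  · exact Finset.sum_eq_zero fun c _ => if_neg fun e => h (by omega)

theorem toLin'_apply_eq_sum {N : ℕ} (A : Matrix (Fin N) (Fin N) ℂ) (v : Fin N → ℂ) (r : Fin N) :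
    Matrix.toLin' A v r = ∑ c, A r c * v c := by
  rw [Matrix.toLin'_apply]
  rfl

theorem Rop_apply (n : ℕ) (v : Fin (n + 1) → ℂ) (r : Fin (n + 1)) :
    Rop n v r = if h : (r : ℕ) + 1 < n + 1 then ((r : ℕ) + 1 : ℂ) * v ⟨r + 1, h⟩ else 0 := by
  refine (toLin'_apply_eq_sum _ v _).trans ?_
  simp only [ite_mul, zero_mul]
  rw [sum_fin_ite_val_eq (fun c => ((c : ℕ) : ℂ) * v c)]
  push_cast
  rfl

theorem Mop_apply (n k : ℕ) (v : Fin (n + 1) → ℂ) (r : Fin (n + 1)) :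
    Mop n k v r = if h : (r : ℕ) + k < n + 1 then
      ((k + (r : ℕ)).choose r : ℂ) * v ⟨r + k, h⟩ else 0 := by
  refine (toLin'_apply_eq_sum _ v _).trans ?_
  simp only [ite_mul, zero_mul]
  rw [sum_fin_ite_val_eq (fun c => ((k + (r : ℕ)).choose r : ℂ) * v c)]

theorem Lop_apply_zero (n : ℕ) (v : Fin (n + 1) → ℂ) (h : 0 < n + 1) :
    Lop n v ⟨0, h⟩ = 0 := by
  refine (toLin'_apply_eq_sum _ v _).trans ?_
  simp

theorem Lop_apply_succ (n : ℕ) (v : Fin (n + 1) → ℂ) (s : ℕ) (h : s + 1 < n + 1) :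
    Lop n v ⟨s + 1, h⟩ = ((n : ℂ) - s) * v ⟨s, by omega⟩ := by
  refine (toLin'_apply_eq_sum _ v _).trans ?_
  simp only [ite_mul, zero_mul,
    Nat.add_right_cancel_iff, eq_comm (a := s)]
  rw [sum_fin_ite_val_eq (fun c => ((n : ℂ) - (c : ℕ)) * v c), dif_pos (by omega)]

theorem Hop_apply (n : ℕ) (v : Fin (n + 1) → ℂ) (r : Fin (n + 1)) :
    Hop n v r = ((n : ℂ) - 2 * (r : ℕ)) * v r := by
  have hRL : Rop n (Lop n v) r = ((r : ℕ) + 1 : ℂ) * (((n : ℂ) - (r : ℕ)) * v r) := by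
    rw [Rop_apply]
    split_ifs with h
    · rw [Lop_apply_succ]
    · have : (r : ℕ) = n := by omega
      simp [this]
  have hLR : Lop n (Rop n v) r = ((n : ℂ) + 1 - (r : ℕ)) * ((r : ℕ) * v r) := by
    obtain ⟨_ | s, hs⟩ := r
    · rw [Lop_apply_zero]
      simp
    · rw [Lop_apply_succ, Rop_apply, dif_pos hs]
      push_cast
      ring
  simp only [Hop, LinearMap.sub_apply, LinearMap.comp_apply, Pi.sub_apply, hRL, hLR]
  ring

/-- `M_k` is a highest weight vector of weight `2k` for the adjoint `sl(2)`-action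
on `End(V_n)`: it is killed by `ad R_n` and has `ad H_n`-eigenvalue `2k`. -/
theorem Mop_highest_weight (n k : ℕ) (hk : k ≤ n) :
    (Rop n).comp (Mop n k) - (Mop n k).comp (Rop n) = 0 ∧
    (Hop n).comp (Mop n k) - (Mop n k).comp (Hop n) = ((2 * k : ℕ) : ℂ) • Mop n k := by
  constructor
  · refine LinearMap.ext fun v => funext fun r => ?_
    simp only [LinearMap.sub_apply, LinearMap.comp_apply, Pi.sub_apply, LinearMap.zero_apply,
      Pi.zero_apply, sub_eq_zero]
    rw [Rop_apply, Mop_apply]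
    by_cases h : (r : ℕ) + k + 1 < n + 1
    · have hidx : (r : ℕ) + 1 + k = r + k + 1 := by omega
      have hchoose : ((r : ℕ) + 1 : ℂ) * ((k + (r + 1 : ℕ)).choose (r + 1) : ℂ) =
          ((k + (r : ℕ)).choose r : ℂ) * ((r : ℕ) + k + 1) := by
        have := Nat.add_one_mul_choose_eq (k + r) r
        have := congrArg (Nat.cast : ℕ → ℂ) this
        push_cast [← add_assoc] at this ⊢
        linear_combination -this
      rw [dif_pos (by omega), dif_pos (by omega), Mop_apply, Rop_apply, dif_pos h,
        dif_pos (by simpa [hidx] using h)]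
      simp only [hidx]
      rw [← mul_assoc, ← mul_assoc, hchoose]
      push_cast
      rfl
    · trans (0 : ℂ)
      · split_ifs with h1
        · rw [Mop_apply, dif_neg (by simp only; omega), mul_zero]
        · rfl
      · split_ifs with h1
        · rw [Rop_apply, dif_neg (by simpa using h), mul_zero]
        · rfl
  · refine LinearMap.ext fun v => funext fun r => ?_
    simp only [LinearMap.sub_apply, LinearMap.comp_apply, Pi.sub_apply, LinearMap.smul_apply,
      Pi.smul_apply, smul_eq_mul, Hop_apply, Mop_apply]
    split_ifs with h
    · push_cast
      ring
    · simp
end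
end

section
/- For all integers n ≥ 0 and 0 ≤ i ≤ n, one has B_{n,n,i} = (−1)^i (n!)² binom(n,i). -/
/-- `B_{n,k,i} = Σ_{a+b=k} (−1)^a binom(n,i) binom(i,a) binom(n−i,b) (n−i+a)! (i+b)!`. -/
def B (n k i : ℕ) : ℤ :=
  ∑ a ∈ Finset.range (k + 1),
    (-1 : ℤ) ^ a * (Nat.choose n i : ℤ) * (Nat.choose i a : ℤ)
      * (Nat.choose (n - i) (k - a) : ℤ)
      * (Nat.factorial (n - i + a) : ℤ) * (Nat.factorial (i + (k - a)) : ℤ)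

/-- `B_{n,n,i} = (−1)^i (n!)² binom(n,i)`. -/
theorem B_n_n (n i : ℕ) (hi : i ≤ n) :
    B n n i = (-1 : ℤ) ^ i * (Nat.factorial n : ℤ) ^ 2 * (Nat.choose n i : ℤ) := by
  unfold B
  rw [Finset.sum_eq_single_of_mem i (Finset.mem_range.2 (by omega))]
  · rw [Nat.choose_self, Nat.choose_self, Nat.sub_add_cancel hi, Nat.add_sub_cancel' hi]
    push_cast
    ring
  · intro a ha hne
    rw [Finset.mem_range] at ha
    rcases lt_or_gt_of_ne hne with h | h
    · simp [Nat.choose_eq_zero_of_lt (show n - i < n - a by omega)]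
    · simp [Nat.choose_eq_zero_of_lt h]
end

section
/- For all integers n ≥ 1 and 0 ≤ i ≤ n, one has (as integers, where n − 2i may be negative) B_{n,n−1,i} = (−1)^i n! (n−1)! binom(n,i) (n − 2i). -/
/-- `B_{n,n−1,i} = (−1)^i n! (n−1)! binom(n,i) (n − 2i)`. -/
theorem B_n_nsub1 (n i : ℕ) (hn : 1 ≤ n) (hi : i ≤ n) :
    B n (n - 1) i
      = (-1 : ℤ) ^ i * (Nat.factorial n : ℤ) * (Nat.factorial (n - 1) : ℤ)
        * (Nat.choose n i : ℤ) * ((n : ℤ) - 2 * (i : ℤ)) := by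
  obtain ⟨m, rfl⟩ := Nat.exists_eq_add_of_le hi
  unfold B
  rw [Nat.add_sub_cancel_left]
  rcases i with _ | j
  · obtain ⟨l, rfl⟩ : ∃ l, m = l + 1 := ⟨m - 1, by omega⟩
    rw [Finset.sum_eq_single 0]
    · simp
      ring
    · intro a _ ha
      simp [Nat.choose_eq_zero_of_lt (Nat.pos_of_ne_zero ha)]
    · simp
  · rcases m with _ | l
    · rw [Finset.sum_eq_single j]
      · simp
        ring
      · intro a ha hne
        have := Finset.mem_range.mp ha
        rw [Nat.choose_eq_zero_of_lt (show 0 < j + 1 + 0 - 1 - a by omega)]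
        simp
      · simp
    · rw [Finset.sum_eq_add j (j + 1) (by omega)]
      · rw [show j + 1 + (l + 1) - 1 - j = l + 1 by omega,
          show j + 1 + (l + 1) - 1 - (j + 1) = l by omega,
          show j + 1 + (l + 1) - 1 = j + 1 + l by omega,
          show l + 1 + j = j + 1 + l by omega,
          show l + 1 + (j + 1) = j + 1 + (l + 1) by omega]
        simp only [Nat.choose_self, Nat.choose_succ_self_right]
        push_cast
        ring
      · intro a _ hne
        rcases lt_or_gt_of_ne hne.1 with h | h
        · rw [Nat.choose_eq_zero_of_lt
            (show l + 1 < j + 1 + (l + 1) - 1 - a by omega)]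
          simp
        · rw [Nat.choose_eq_zero_of_lt (show j + 1 < a by omega)]
          simp
      · intro h
        exact absurd (Finset.mem_range.mpr (by omega)) h
      · intro h
        exact absurd (Finset.mem_range.mpr (by omega)) h
end

section
/- For all integers n ≥ 1 and 0 ≤ i ≤ n, one has (as integers) B_{2n,2n−1,n+i} − B_{2n,2n−1,n−i} = (−1)^{n+i+1} · 4 · i · (2n)! · (2n−1)! · binom(2n, n+i); in other words, up to a nonzero scalar factor independent of i, the difference B_{2n,2n−1,n+i} − B_{2n,2n−1,n−i} equals (−1)^i binom(2n, n+i) i. -/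
/-- Only the summands `a = m` and `a = m - 1` of `B_{M+1,M,m}` survive. -/
theorem B_succ_self (M m : ℕ) (hm : m ≤ M + 1) :
    B (M + 1) M m = (-1 : ℤ) ^ m * (Nat.choose (M + 1) m : ℤ) * ((M : ℤ) + 1 - 2 * m)
      * (Nat.factorial (M + 1) : ℤ) * (Nat.factorial M : ℤ) := by
  set C : ℤ := (Nat.choose (M + 1) m : ℤ) * (Nat.factorial (M + 1) : ℤ) * (Nat.factorial M : ℤ)
    with hC
  have key : ∀ a ∈ Finset.range (M + 1),
      (-1 : ℤ) ^ a * (Nat.choose (M + 1) m : ℤ) * (Nat.choose m a : ℤ)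
        * (Nat.choose (M + 1 - m) (M - a) : ℤ)
        * (Nat.factorial (M + 1 - m + a) : ℤ) * (Nat.factorial (m + (M - a)) : ℤ)
      = (if a = m then (-1 : ℤ) ^ m * ((M : ℤ) + 1 - m) * C else 0)
        + (if a + 1 = m then (-1 : ℤ) ^ (m + 1) * (m : ℤ) * C else 0) := by
    intro a ha
    have ha' : a ≤ M := Nat.lt_succ_iff.mp (Finset.mem_range.mp ha)
    obtain ⟨b, rfl⟩ := Nat.exists_eq_add_of_le ha'
    rw [Nat.add_sub_cancel_left]
    rcases lt_trichotomy a m with h | rfl | h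
    · by_cases h1 : a + 1 = m
      · subst h1
        have e1 : a + b + 1 - (a + 1) = b := by omega
        have e2 : a + 1 + b = a + b + 1 := by omega
        rw [e1, e2, Nat.add_comm b a, Nat.choose_succ_self_right, Nat.choose_self,
          if_neg (by omega), if_pos rfl, hC]
        push_cast
        ring
      · rw [Nat.choose_eq_zero_of_lt (show a + b + 1 - m < b by omega), if_neg (by omega),
          if_neg h1]
        simp
    · have e1 : a + b + 1 - a = b + 1 := by omega
      have e2 : b + 1 + a = a + b + 1 := by omega
      rw [e1, e2, Nat.choose_succ_self_right, Nat.choose_self, if_pos rfl, if_neg (by omega), hC]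
      push_cast
      ring
    · rw [Nat.choose_eq_zero_of_lt h, if_neg (by omega), if_neg (by omega)]
      simp
  have lower : ∑ a ∈ Finset.range (M + 1),
      (if a = m then (-1 : ℤ) ^ m * ((M : ℤ) + 1 - m) * C else 0)
        = (-1 : ℤ) ^ m * ((M : ℤ) + 1 - m) * C := by
    rw [Finset.sum_ite_eq']
    split_ifs with h
    · rfl
    · obtain rfl : m = M + 1 := le_antisymm hm (by simpa using h)
      push_cast
      ring
  have upper : ∑ a ∈ Finset.range (M + 1),
      (if a + 1 = m then (-1 : ℤ) ^ (m + 1) * (m : ℤ) * C else 0)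
        = (-1 : ℤ) ^ (m + 1) * (m : ℤ) * C := by
    cases m with
    | zero => simp
    | succ k =>
      simp only [Nat.add_right_cancel_iff]
      rw [Finset.sum_ite_eq', if_pos (Finset.mem_range.mpr hm)]
  rw [B, Finset.sum_congr rfl key, Finset.sum_add_distrib, lower, upper, hC]
  ring

/-- `B_{2n,2n−1,n+i} − B_{2n,2n−1,n−i} = (−1)^{n+i+1} · 4 · i · (2n)! · (2n−1)! · binom(2n, n+i)`;
i.e. up to a nonzero scalar independent of `i`, the difference equals `(−1)^i binom(2n,n+i) i`. -/
theorem B_symplectic_difference (n i : ℕ) (hn : 1 ≤ n) (hi : i ≤ n) :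
    B (2 * n) (2 * n - 1) (n + i) - B (2 * n) (2 * n - 1) (n - i)
      = (-1 : ℤ) ^ (n + i + 1) * 4 * (i : ℤ) * (Nat.factorial (2 * n) : ℤ)
        * (Nat.factorial (2 * n - 1) : ℤ) * (Nat.choose (2 * n) (n + i) : ℤ) := by
  obtain ⟨M, hM⟩ : ∃ M, 2 * n = M + 1 := ⟨2 * n - 1, by omega⟩
  have hc : Nat.choose (M + 1) (n - i) = Nat.choose (M + 1) (n + i) :=
    Nat.choose_symm_of_eq_add (by omega)
  have hs : (-1 : ℤ) ^ (n - i) = (-1) ^ (n + i) := by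
    rw [show n + i = n - i + 2 * i by omega, pow_add, pow_mul]
    simp
  have hMz : (M : ℤ) + 1 = 2 * n := by exact_mod_cast hM.symm
  rw [hM, Nat.add_sub_cancel, B_succ_self M (n + i) (by omega), B_succ_self M (n - i) (by omega),
    hc, hs, hMz]
  push_cast [Nat.cast_sub hi]
  ring
end
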